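/- Let n ≥ 9 be even and D = (d_{ij}) a standardized n×n array. Let π be uniform on Π_n, and independently let (I†, J†, K†, L†) have the joint distribution p(i,j,k,l) = c_n [d_{ik} + d_{jl} − (d_{ij} + d_{kl})]² · 1(i, j, k, l are distinct), where c_n = 1/(2(n−1)²(n−3)). Let π† be constructed from π and (I†, J†, K†, L†) by the ten-case rule of the coupling construction. Then for every quadruple (i,j,k,l) of distinct indices with p(i,j,k,l) > 0 and every φ ∈ Π_n with φ(i) = k and φ(j) = l, P(π† = φ | (I†, J†, K†, L†) = (i,j,k,l)) = 1/|Π_{n−4}|; that is, conditionally on the selected indices, π† is uniform over the fixed-point-free involutions having cycles (i,k) and (j,l). -/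

import Mathlib

open Finset

/-- The set of fixed-point-free involutions of `{1,…,n}`. -/
def fpfInvolutions (n : ℕ) : Finset (Equiv.Perm (Fin n)) :=
  Finset.univ.filter fun π => π * π = 1 ∧ ∀ i, π i ≠ i

/-- `α^π_{a,b} = τ_{a,π(b)} τ_{b,π(a)}`. -/
def alphaPerm {n : ℕ} (π : Equiv.Perm (Fin n)) (a b : Fin n) : Equiv.Perm (Fin n) :=
  Equiv.swap a (π b) * Equiv.swap b (π a)

/-- The ten-case construction of `π†` from `π ∈ Π_n` and four distinct indices `i,j,k,l`. -/
def piDagger {n : ℕ} (π : Equiv.Perm (Fin n)) (i j k l : Fin n) : Equiv.Perm (Fin n) :=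
  if π i = k ∧ π j ≠ l then π * alphaPerm π j l
  else if π i ≠ k ∧ π j = l then π * alphaPerm π i k
  else if π i = l ∧ π j ≠ k then π * alphaPerm π j k * Equiv.swap i j * Equiv.swap k l
  else if π i ≠ l ∧ π j = k then π * alphaPerm π i l * Equiv.swap i j * Equiv.swap k l
  else if π i = j ∧ π k ≠ l then π * alphaPerm π k l * Equiv.swap i l * Equiv.swap j k
  else if π i ≠ j ∧ π k = l then π * alphaPerm π i j * Equiv.swap i l * Equiv.swap j k
  else if π i = k ∧ π j = l then π
  else if π i = j ∧ π k = l then π * Equiv.swap i l * Equiv.swap j k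
  else if π i = l ∧ π j = k then π * Equiv.swap i j * Equiv.swap k l
  else π * alphaPerm π i k * alphaPerm π j l

/-- The predicate defining `fpfInvolutions`, on an arbitrary type. -/
def IsFPFInvolution {α : Type*} (π : Equiv.Perm α) : Prop :=
  π * π = 1 ∧ ∀ x, π x ≠ x

theorem mem_fpfInvolutions {n : ℕ} {π : Equiv.Perm (Fin n)} :
    π ∈ fpfInvolutions n ↔ IsFPFInvolution π := by
  simp [fpfInvolutions, IsFPFInvolution]

namespace IsFPFInvolution

variable {α : Type*} {π θ : Equiv.Perm α}

theorem apply_apply (h : IsFPFInvolution π) (x : α) : π (π x) = x := by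
  simpa using DFunLike.congr_fun h.1 x

theorem inv_eq (h : IsFPFInvolution π) : π⁻¹ = π := inv_eq_of_mul_eq_one_left h.1

theorem conj (h : IsFPFInvolution π) (σ : Equiv.Perm α) : IsFPFInvolution (σ * π * σ⁻¹) := by
  refine ⟨?_, fun x hx => h.2 (σ⁻¹ x) ?_⟩
  · rw [conj_mul, h.1, mul_one, mul_inv_cancel]
  · rwa [Equiv.Perm.eq_inv_iff_eq]

/-- Multiplying an involution by `τ_{a,b} τ_{π(a),π(b)}` conjugates it by `τ_{a,b}`. -/
theorem mul_swap_mul_swap [DecidableEq α] (h : IsFPFInvolution π) (a b : α) :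
    π * Equiv.swap (π a) (π b) * Equiv.swap a b = Equiv.swap a b * π * (Equiv.swap a b)⁻¹ := by
  rw [Equiv.swap_apply_apply, h.inv_eq, ← mul_assoc, ← mul_assoc, h.1, one_mul, Equiv.swap_inv]

theorem mul_swap_mul_swap_of_apply [DecidableEq α] (h : IsFPFInvolution π) {a b c d : α}
    (hac : π a = c) (hbd : π b = d) : IsFPFInvolution (π * Equiv.swap a b * Equiv.swap c d) := by
  subst hac hbd
  have := h.mul_swap_mul_swap (π a) (π b)
  rw [h.apply_apply, h.apply_apply] at this
  rw [this]
  exact h.conj _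

theorem isConj [Fintype α] [DecidableEq α] (hπ : IsFPFInvolution π) (hθ : IsFPFInvolution θ) :
    IsConj π θ := by
  have key : ∀ {ρ : Equiv.Perm α}, IsFPFInvolution ρ → ρ.cycleType =
      Multiset.replicate (Fintype.card α / 2) 2 := by
    intro ρ hρ
    have htype := Equiv.Perm.cycleType_of_pow_prime_eq_one (p := 2) (by rw [sq, hρ.1])
    have hsupp : ρ.support = Finset.univ := by
      ext x
      simp [hρ.2 x]
    have hsum := ρ.sum_cycleType
    rw [hsupp, htype, Multiset.sum_replicate, Finset.card_univ, smul_eq_mul] at hsum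
    rw [htype, ← hsum, Nat.mul_div_cancel _ two_pos]
  rw [Equiv.Perm.isConj_iff_cycleType_eq, key hπ, key hθ]

end IsFPFInvolution

section alphaPerm

variable {n : ℕ} {π : Equiv.Perm (Fin n)}

theorem IsFPFInvolution.mul_alphaPerm (h : IsFPFInvolution π) (a b : Fin n) :
    IsFPFInvolution (π * alphaPerm π a b) := by
  rw [alphaPerm, ← mul_assoc, Equiv.swap_comm b]
  exact h.mul_swap_mul_swap_of_apply rfl (h.apply_apply b)

theorem mul_alphaPerm_apply_left (h : IsFPFInvolution π) {a b : Fin n} (hab : a ≠ b) :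
    (π * alphaPerm π a b) a = b := by
  rw [alphaPerm, Equiv.Perm.mul_apply, Equiv.Perm.mul_apply,
    Equiv.swap_apply_of_ne_of_ne hab (h.2 a).symm, Equiv.swap_apply_left, h.apply_apply]

theorem mul_alphaPerm_apply_of_ne {a b x : Fin n} (hxa : x ≠ a) (hxb : x ≠ b)
    (hxa' : x ≠ π a) (hxb' : x ≠ π b) : (π * alphaPerm π a b) x = π x := by
  rw [alphaPerm, Equiv.Perm.mul_apply, Equiv.Perm.mul_apply,
    Equiv.swap_apply_of_ne_of_ne hxb hxa', Equiv.swap_apply_of_ne_of_ne hxa hxb']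

theorem alphaPerm_conj (σ π : Equiv.Perm (Fin n)) (a b : Fin n) :
    alphaPerm (σ * π * σ⁻¹) (σ a) (σ b) = σ * alphaPerm π a b * σ⁻¹ := by
  simp [alphaPerm, Equiv.swap_apply_apply, mul_assoc]

end alphaPerm

section piDagger

variable {n : ℕ} {π : Equiv.Perm (Fin n)}

theorem piDagger_conj (σ π : Equiv.Perm (Fin n)) (i j k l : Fin n) :
    piDagger (σ * π * σ⁻¹) (σ i) (σ j) (σ k) (σ l) = σ * piDagger π i j k l * σ⁻¹ := by
  have hσ : ∀ x y, (σ * π * σ⁻¹) (σ x) = σ y ↔ π x = y := by simp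
  unfold piDagger
  simp only [ne_eq, hσ, alphaPerm_conj, Equiv.swap_apply_apply]
  simp only [mul_ite, ite_mul, mul_assoc, inv_mul_cancel_left]

/-- `π†` is again a fixed-point-free involution, and it has the cycles `(i,k)` and `(j,l)`. -/
theorem piDagger_spec (h : IsFPFInvolution π) {i j k l : Fin n} (hij : i ≠ j) (hik : i ≠ k)
    (hil : i ≠ l) (hjk : j ≠ k) (hjl : j ≠ l) (hkl : k ≠ l) :
    IsFPFInvolution (piDagger π i j k l) ∧ piDagger π i j k l i = k ∧
      piDagger π i j k l j = l := by
  have hinv : ∀ {x y}, π x = y → π y = x := fun hxy => hxy ▸ h.apply_apply _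
  have cross : ∀ {ρ : Equiv.Perm (Fin n)}, IsFPFInvolution ρ → ρ i = l → ρ j = k →
      IsFPFInvolution (ρ * Equiv.swap i j * Equiv.swap k l) ∧
        (ρ * Equiv.swap i j * Equiv.swap k l) i = k ∧
        (ρ * Equiv.swap i j * Equiv.swap k l) j = l := by
    intro ρ hρ hi hj
    refine ⟨Equiv.swap_comm k l ▸ hρ.mul_swap_mul_swap_of_apply hi hj, ?_, ?_⟩
    · simp [Equiv.swap_apply_of_ne_of_ne hik hil, hj]
    · simp [Equiv.swap_apply_of_ne_of_ne hjk hjl, hi]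
  have cross' : ∀ {ρ : Equiv.Perm (Fin n)}, IsFPFInvolution ρ → ρ i = j → ρ k = l →
      IsFPFInvolution (ρ * Equiv.swap i l * Equiv.swap j k) ∧
        (ρ * Equiv.swap i l * Equiv.swap j k) i = k ∧
        (ρ * Equiv.swap i l * Equiv.swap j k) j = l := by
    intro ρ hρ hi hk
    have hl : ρ l = k := hk ▸ hρ.apply_apply k
    refine ⟨hρ.mul_swap_mul_swap_of_apply hi hl, ?_, ?_⟩
    · simp [Equiv.swap_apply_of_ne_of_ne hij hik, hl]
    · simp [Equiv.swap_apply_of_ne_of_ne hik.symm hkl, hk]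
  unfold piDagger
  split_ifs with h₁ h₂ h₃ h₄ h₅ h₆ h₇ h₈ h₉
  · exact ⟨h.mul_alphaPerm j l, (mul_alphaPerm_apply_of_ne hij hil (by grind) (by grind)).trans
      h₁.1, mul_alphaPerm_apply_left h hjl⟩
  · exact ⟨h.mul_alphaPerm i k, mul_alphaPerm_apply_left h hik,
      (mul_alphaPerm_apply_of_ne hij.symm hjk (by grind) (by grind)).trans h₂.2⟩
  · exact cross (h.mul_alphaPerm j k) ((mul_alphaPerm_apply_of_ne hij hik (by grind)
      (by grind)).trans h₃.1) (mul_alphaPerm_apply_left h hjk)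
  · exact cross (h.mul_alphaPerm i l) (mul_alphaPerm_apply_left h hil)
      ((mul_alphaPerm_apply_of_ne hij.symm hjl (by grind) (by grind)).trans h₄.2)
  · exact cross' (h.mul_alphaPerm k l) ((mul_alphaPerm_apply_of_ne hik hil (by grind)
      (by grind)).trans h₅.1) (mul_alphaPerm_apply_left h hkl)
  · exact cross' (h.mul_alphaPerm i j) (mul_alphaPerm_apply_left h hij)
      ((mul_alphaPerm_apply_of_ne hik.symm hjk.symm (by grind) (by grind)).trans h₆.2)
  · exact ⟨h, h₇⟩
  · exact cross' h h₈.1 h₈.2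
  · exact cross h h₉.1 h₉.2
  · have hj : (π * alphaPerm π i k) j = π j :=
      mul_alphaPerm_apply_of_ne hij.symm hjk (by grind) (by grind)
    have hl : (π * alphaPerm π i k) l = π l :=
      mul_alphaPerm_apply_of_ne hil.symm hkl.symm (by grind) (by grind)
    have hi : (π * alphaPerm π i k) i = k := mul_alphaPerm_apply_left h hik
    have hα : alphaPerm π j l = alphaPerm (π * alphaPerm π i k) j l := by
      rw [alphaPerm, alphaPerm, hj, hl]
    have hρ := h.mul_alphaPerm i k
    rw [hα]
    refine ⟨hρ.mul_alphaPerm j l, ?_, mul_alphaPerm_apply_left hρ hjl⟩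
    rw [mul_alphaPerm_apply_of_ne hij hil (by grind) (by grind), hi]

end piDagger

section extension

variable {m n : ℕ} {i j k l : Fin n}

/-- Extend a permutation of the complement of `{i,j,k,l}` by the cycles `(i,k)` and `(j,l)`. -/
def extendByCycles (e : Fin m ≃ {x : Fin n // x ∉ ({i, j, k, l} : Finset (Fin n))})
    (θ : Equiv.Perm (Fin m)) : Equiv.Perm (Fin n) :=
  θ.extendDomain e * (Equiv.swap i k * Equiv.swap j l)

variable (e : Fin m ≃ {x : Fin n // x ∉ ({i, j, k, l} : Finset (Fin n))})
  (θ : Equiv.Perm (Fin m))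

theorem extendDomain_apply_of_mem {x : Fin n} (hx : x ∈ ({i, j, k, l} : Finset (Fin n))) :
    θ.extendDomain e x = x :=
  Equiv.Perm.extendDomain_apply_not_subtype _ _ (not_not.2 hx)

theorem extendByCycles_apply_coe (y : Fin m) : extendByCycles e θ (e y) = e (θ y) := by
  have hy := (e y).2
  simp only [Finset.mem_insert, Finset.mem_singleton, not_or] at hy
  obtain ⟨h1, h2, h3, h4⟩ := hy
  rw [extendByCycles, Equiv.Perm.mul_apply, Equiv.Perm.mul_apply,
    Equiv.swap_apply_of_ne_of_ne h2 h4, Equiv.swap_apply_of_ne_of_ne h1 h3,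
    Equiv.Perm.extendDomain_apply_image]

theorem extendByCycles_apply_of_mem {x : Fin n} (hx : x ∈ ({i, j, k, l} : Finset (Fin n))) :
    extendByCycles e θ x = (Equiv.swap i k * Equiv.swap j l) x := by
  rw [extendByCycles, Equiv.Perm.mul_apply, extendDomain_apply_of_mem]
  simp only [Finset.mem_insert, Finset.mem_singleton] at hx
  rw [Equiv.Perm.mul_apply]
  simp only [Equiv.swap_apply_def, Finset.mem_insert, Finset.mem_singleton]
  grind

theorem extendByCycles_injective : Function.Injective (extendByCycles e) := fun _ _ h =>
  Equiv.Perm.extendDomainHom_injective e (mul_right_cancel h)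

theorem extendByCycles_conj (σ : Equiv.Perm (Fin m)) :
    extendByCycles e (σ * θ * σ⁻¹) =
      σ.extendDomain e * extendByCycles e θ * (σ.extendDomain e)⁻¹ := by
  have hs : ∀ {a b : Fin n}, a ∈ ({i, j, k, l} : Finset (Fin n)) →
      b ∈ ({i, j, k, l} : Finset (Fin n)) →
      Commute (Equiv.swap a b) (σ.extendDomain e)⁻¹ := by
    intro a b ha hb
    refine Commute.inv_right ?_
    have := Equiv.swap_apply_apply (σ.extendDomain e) a b
    rw [extendDomain_apply_of_mem e σ ha, extendDomain_apply_of_mem e σ hb,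
      eq_mul_inv_iff_mul_eq] at this
    exact this
  have hc := (hs (a := i) (b := k) (by simp) (by simp)).mul_left
    (hs (a := j) (b := l) (by simp) (by simp))
  rw [extendByCycles, extendByCycles, ← Equiv.Perm.extendDomain_mul,
    ← Equiv.Perm.extendDomain_mul, ← Equiv.Perm.extendDomain_inv]
  simp only [mul_assoc]
  rw [← mul_assoc (Equiv.swap i k), hc.eq]

variable {θ} in
theorem isFPFInvolution_extendByCycles (hθ : IsFPFInvolution θ) (hij : i ≠ j) (hik : i ≠ k)
    (hil : i ≠ l) (hjk : j ≠ k) (hjl : j ≠ l) (hkl : k ≠ l) :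
    IsFPFInvolution (extendByCycles e θ) ∧ extendByCycles e θ i = k ∧
      extendByCycles e θ j = l := by
  have hi : extendByCycles e θ i = k := by
    simp [extendByCycles_apply_of_mem, Equiv.swap_apply_of_ne_of_ne hij hil]
  have hj : extendByCycles e θ j = l := by
    simp [extendByCycles_apply_of_mem, Equiv.swap_apply_of_ne_of_ne hil.symm hkl.symm]
  have hk : extendByCycles e θ k = i := by
    simp [extendByCycles_apply_of_mem, Equiv.swap_apply_of_ne_of_ne hjk.symm hkl]
  have hl : extendByCycles e θ l = j := by
    simp [extendByCycles_apply_of_mem, Equiv.swap_apply_of_ne_of_ne hij.symm hjk]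
  have key : ∀ x, extendByCycles e θ (extendByCycles e θ x) = x ∧ extendByCycles e θ x ≠ x := by
    intro x
    by_cases hx : x ∈ ({i, j, k, l} : Finset (Fin n))
    · simp only [Finset.mem_insert, Finset.mem_singleton] at hx
      rcases hx with rfl | rfl | rfl | rfl
      · exact ⟨by rw [hi, hk], by rw [hi]; exact hik.symm⟩
      · exact ⟨by rw [hj, hl], by rw [hj]; exact hjl.symm⟩
      · exact ⟨by rw [hk, hi], by rw [hk]; exact hik⟩
      · exact ⟨by rw [hl, hj], by rw [hl]; exact hjl⟩
    · obtain ⟨y, hy⟩ := e.surjective ⟨x, hx⟩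
      obtain rfl : (e y : Fin n) = x := congrArg Subtype.val hy
      rw [extendByCycles_apply_coe, extendByCycles_apply_coe, hθ.apply_apply]
      exact ⟨rfl, fun h => hθ.2 y (e.injective (Subtype.ext h))⟩
  exact ⟨⟨Equiv.ext fun x => (key x).1, fun x => (key x).2⟩, hi, hj⟩

theorem exists_extendByCycles_eq {φ : Equiv.Perm (Fin n)} (hφ : IsFPFInvolution φ)
    (hij : i ≠ j) (hil : i ≠ l) (hjk : j ≠ k) (hkl : k ≠ l) (hi : φ i = k) (hj : φ j = l) :
    ∃ θ : Equiv.Perm (Fin m), IsFPFInvolution θ ∧ extendByCycles e θ = φ := by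
  have hk : φ k = i := hi ▸ hφ.apply_apply i
  have hl : φ l = j := hj ▸ hφ.apply_apply j
  have hmem : ∀ x, φ x ∉ ({i, j, k, l} : Finset (Fin n)) ↔
      x ∉ ({i, j, k, l} : Finset (Fin n)) := by
    intro x
    have := hφ.apply_apply x
    simp only [Finset.mem_insert, Finset.mem_singleton]
    grind
  let θ : Equiv.Perm (Fin m) := e.symm.permCongr (φ.subtypePerm hmem)
  have hθ : ∀ y, (e (θ y) : Fin n) = φ (e y) := fun y => by simp [θ]
  refine ⟨θ, ⟨Equiv.ext fun y => ?_, fun y hy => hφ.2 (e y) (by rw [← hθ, hy])⟩,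
    Equiv.ext fun x => ?_⟩
  · apply e.injective
    apply Subtype.ext
    rw [Equiv.Perm.mul_apply, hθ, hθ, hφ.apply_apply, Equiv.Perm.one_apply]
  · by_cases hx : x ∈ ({i, j, k, l} : Finset (Fin n))
    · rw [extendByCycles_apply_of_mem e θ hx]
      simp only [Finset.mem_insert, Finset.mem_singleton] at hx
      simp only [Equiv.Perm.mul_apply, Equiv.swap_apply_def]
      grind
    · obtain ⟨y, hy⟩ := e.surjective ⟨x, hx⟩
      obtain rfl : (e y : Fin n) = x := congrArg Subtype.val hy
      rw [extendByCycles_apply_coe, hθ]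

end extension

/-- Conditionally on the selected indices `(i,j,k,l)` (chosen with the square-bias
distribution `p`, independently of the uniform `π ∈ Π_n`), the permutation `π†` produced by
the ten-case rule is uniform over the fixed-point-free involutions having cycles `(i,k)`
and `(j,l)`: for every such `φ`, `P(π† = φ) = 1/|Π_{n−4}|`. -/
theorem piDagger_conditionally_uniform (n : ℕ) (hn : Even n) (hn9 : 9 ≤ n)
    (d : Fin n → Fin n → ℝ)
    (hsymm : ∀ i j, d i j = d j i) (hdiag : ∀ i, d i i = 0)
    (hrow : ∀ i, ∑ j, d i j = 0)
    (hvar : 2 * ((n : ℝ) - 2) / (((n : ℝ) - 1) * ((n : ℝ) - 3)) *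
      (∑ i, ∑ j, d i j ^ 2) = 1)
    (i j k l : Fin n) (hij : i ≠ j) (hik : i ≠ k) (hil : i ≠ l)
    (hjk : j ≠ k) (hjl : j ≠ l) (hkl : k ≠ l)
    (hp : 0 < 1 / (2 * ((n : ℝ) - 1) ^ 2 * ((n : ℝ) - 3)) *
      (d i k + d j l - (d i j + d k l)) ^ 2)
    (φ : Equiv.Perm (Fin n)) (hφinv : φ * φ = 1) (hφfpf : ∀ x, φ x ≠ x)
    (hφik : φ i = k) (hφjl : φ j = l) :
    (((fpfInvolutions n).filter (fun π => piDagger π i j k l = φ)).card : ℝ) /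
        ((fpfInvolutions n).card : ℝ) =
      1 / ((fpfInvolutions (n - 4)).card : ℝ) := by
  have hφ : IsFPFInvolution φ := ⟨hφinv, hφfpf⟩
  have hcard : Fintype.card {x : Fin n // x ∉ ({i, j, k, l} : Finset (Fin n))} = n - 4 := by
    rw [Fintype.card_subtype_compl, Fintype.card_fin, Fintype.card_coe]
    simp [hij, hik, hil, hjk, hjl, hkl]
  let e := (Fintype.equivFinOfCardEq hcard).symm
  let T := (fpfInvolutions n).filter fun ψ => ψ i = k ∧ ψ j = l
  have hT : T = (fpfInvolutions (n - 4)).image (extendByCycles e) := by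
    ext ψ
    simp only [T, Finset.mem_filter, Finset.mem_image, mem_fpfInvolutions]
    constructor
    · rintro ⟨hψ, hi, hj⟩
      exact exists_extendByCycles_eq e hψ hij hil hjk hkl hi hj
    · rintro ⟨θ, hθ, rfl⟩
      exact isFPFInvolution_extendByCycles e hθ hij hik hil hjk hjl hkl
  have hfiber : ∀ ψ ∈ T, ((fpfInvolutions n).filter fun π => piDagger π i j k l = ψ).card =
      ((fpfInvolutions n).filter fun π => piDagger π i j k l = φ).card := by
    intro ψ hψ
    rw [hT, Finset.mem_image] at hψ
    obtain ⟨θ', hθ', rfl⟩ := hψ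
    obtain ⟨θ, hθ, rfl⟩ := exists_extendByCycles_eq e hφ hij hil hjk hkl hφik hφjl
    obtain ⟨σ, rfl⟩ := isConj_iff.1 ((mem_fpfInvolutions.1 hθ').isConj hθ)
    set τ := σ.extendDomain e with hτ
    refine Finset.card_equiv (MulAut.conj τ).toEquiv fun π => ?_
    have hdag : piDagger (τ * π * τ⁻¹) i j k l = τ * piDagger π i j k l * τ⁻¹ := by
      have := piDagger_conj τ π i j k l
      rwa [hτ, extendDomain_apply_of_mem (x := i), extendDomain_apply_of_mem (x := j),
        extendDomain_apply_of_mem (x := k), extendDomain_apply_of_mem (x := l)] at this <;> simp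
    have hmem : IsFPFInvolution (τ * π * τ⁻¹) ↔ IsFPFInvolution π :=
      ⟨fun h => by simpa [mul_assoc] using h.conj τ⁻¹, fun h => h.conj τ⟩
    simp [mem_fpfInvolutions, hmem, hdag, extendByCycles_conj, ← hτ]
  have hmaps : ((fpfInvolutions n : Finset _) : Set (Equiv.Perm (Fin n))).MapsTo
      (fun π => piDagger π i j k l) T := by
    intro π hπ
    have := piDagger_spec (mem_fpfInvolutions.1 hπ) hij hik hil hjk hjl hkl
    simpa [T, mem_fpfInvolutions] using this
  have htotal := Finset.card_eq_sum_card_fiberwise hmaps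
  rw [Finset.sum_congr rfl hfiber, Finset.sum_const, smul_eq_mul, hT,
    Finset.card_image_of_injective _ (extendByCycles_injective e)] at htotal
  have hpos : (fpfInvolutions n).card ≠ 0 :=
    Finset.card_ne_zero_of_mem (mem_fpfInvolutions.2 hφ)
  rw [htotal] at hpos ⊢
  push_cast
  have h₁ := left_ne_zero_of_mul hpos
  have h₂ := right_ne_zero_of_mul hpos
  field_simp
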